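/- Let n ≥ 3 and let f be a weak Roman dominating function on the flower snark J_n whose total weight w(f) satisfies w(f) ≤ 3n/2. Then every set of four consecutive copies J^i, J^{i+1}, J^{i+2}, J^{i+3} (indices mod n) has combined weight exactly 6 in f, every copy has weight either 1 or 2 in f, and w(f) = 3n/2. -/

import Mathlib

/-- Vertices of the flower snark `J_n`: a copy index `i : Fin n` together with
one of the four vertices of the copy: `0 = a`, `1 = b`, `2 = c`, `3 = d`. -/
abbrev FV (n : ℕ) := Fin n × Fin 4

/-- The flower snark `J_n`: in each copy, `a^i` is adjacent to `b^i, c^i, d^i`;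
the `b` vertices form an `n`-cycle; the `c` and `d` vertices form a `2n`-cycle
via the paths `c^i c^{i+1}`, `d^i d^{i+1}` (for `1 ≤ i ≤ n-1`) together with the
twist edges `c^n d^1` and `d^n c^1`. -/
def flowerSnark (n : ℕ) : SimpleGraph (FV n) :=
  SimpleGraph.fromRel (fun v w =>
    (v.1 = w.1 ∧ v.2 = 0 ∧ w.2 ≠ 0) ∨
    (((v.1 : ℕ) + 1) % n = (w.1 : ℕ) ∧ v.2 = 1 ∧ w.2 = 1) ∨
    ((v.1 : ℕ) + 1 = (w.1 : ℕ) ∧ v.2 = 2 ∧ w.2 = 2) ∨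
    ((v.1 : ℕ) + 1 = (w.1 : ℕ) ∧ v.2 = 3 ∧ w.2 = 3) ∨
    ((v.1 : ℕ) = n - 1 ∧ (w.1 : ℕ) = 0 ∧ v.2 = 2 ∧ w.2 = 3) ∨
    ((v.1 : ℕ) = n - 1 ∧ (w.1 : ℕ) = 0 ∧ v.2 = 3 ∧ w.2 = 2))

/-- `S` is a dominating set of `J_n`. -/
def Dominating (n : ℕ) (S : Set (FV n)) : Prop :=
  ∀ v ∉ S, ∃ w ∈ S, (flowerSnark n).Adj v w

/-- `S` is a minimal dominating set of `J_n`. -/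
def MinimalDominating (n : ℕ) (S : Set (FV n)) : Prop :=
  Dominating n S ∧ ∀ T : Set (FV n), T ⊂ S → ¬ Dominating n T

/-- `S` is an independent set of `J_n`. -/
def IndependentSet (n : ℕ) (S : Set (FV n)) : Prop :=
  ∀ v ∈ S, ∀ w ∈ S, ¬ (flowerSnark n).Adj v w

/-- `S` is a 2-dominating set of `J_n`: every vertex outside `S` has at least
two neighbours in `S`. -/
def TwoDominating (n : ℕ) (S : Set (FV n)) : Prop :=
  ∀ v ∉ S, ∃ w₁ ∈ S, ∃ w₂ ∈ S, w₁ ≠ w₂ ∧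
    (flowerSnark n).Adj v w₁ ∧ (flowerSnark n).Adj v w₂

/-- `S` is a total dominating set of `J_n`. -/
def TotalDominating (n : ℕ) (S : Set (FV n)) : Prop :=
  ∀ v : FV n, ∃ w ∈ S, (flowerSnark n).Adj v w

/-- `S` is a connected dominating set of `J_n`. -/
def ConnectedDominating (n : ℕ) (S : Set (FV n)) : Prop :=
  Dominating n S ∧ ((flowerSnark n).induce S).Connected

/-- `S` is a secure dominating set of `J_n`. -/
def SecureDominating (n : ℕ) (S : Set (FV n)) : Prop :=
  Dominating n S ∧ ∀ v ∉ S, ∃ w ∈ S,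
    (flowerSnark n).Adj v w ∧ Dominating n (insert v (S \ {w}))

/-- `v` is undefended with respect to `f`: neither `v` nor any of its
neighbours carries a guard. -/
def Undefended (n : ℕ) (f : FV n → ℕ) (v : FV n) : Prop :=
  f v = 0 ∧ ∀ w, (flowerSnark n).Adj v w → f w = 0

/-- `f` is a weak Roman dominating function on `J_n`: `f` takes values in
`{0,1,2}`, has no undefended vertex, and every vertex `v` with `f v = 0` has a
neighbour `w` with `f w ≥ 1` such that moving one guard from `w` to `v` leaves
no undefended vertex. -/
def WeakRomanDominating (n : ℕ) (f : FV n → ℕ) : Prop :=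
  (∀ v, f v ≤ 2) ∧ (∀ v, ¬ Undefended n f v) ∧
  ∀ v, f v = 0 → ∃ w, (flowerSnark n).Adj v w ∧ 1 ≤ f w ∧
    ∀ u, ¬ Undefended n
      (fun x => if x = v then 1 else if x = w then f w - 1 else f x) u

/-- The domination number of `J_n`. -/
noncomputable def dominationNumber (n : ℕ) : ℕ :=
  sInf {k | ∃ S : Set (FV n), Dominating n S ∧ S.ncard = k}

/-- The independent domination number of `J_n`. -/
noncomputable def indepDominationNumber (n : ℕ) : ℕ :=
  sInf {k | ∃ S : Set (FV n), Dominating n S ∧ IndependentSet n S ∧ S.ncard = k}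

/-- The upper domination number of `J_n`: the maximum cardinality of a minimal
dominating set. -/
noncomputable def upperDominationNumber (n : ℕ) : ℕ :=
  sSup {k | ∃ S : Set (FV n), MinimalDominating n S ∧ S.ncard = k}

/-- The 2-domination number of `J_n`. -/
noncomputable def twoDominationNumber (n : ℕ) : ℕ :=
  sInf {k | ∃ S : Set (FV n), TwoDominating n S ∧ S.ncard = k}

/-- The total domination number of `J_n`. -/
noncomputable def totalDominationNumber (n : ℕ) : ℕ :=
  sInf {k | ∃ S : Set (FV n), TotalDominating n S ∧ S.ncard = k}

/-- The connected domination number of `J_n`. -/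
noncomputable def connectedDominationNumber (n : ℕ) : ℕ :=
  sInf {k | ∃ S : Set (FV n), ConnectedDominating n S ∧ S.ncard = k}

/-- The secure domination number of `J_n`. -/
noncomputable def secureDominationNumber (n : ℕ) : ℕ :=
  sInf {k | ∃ S : Set (FV n), SecureDominating n S ∧ S.ncard = k}

/-- The weak Roman domination number of `J_n`. -/
noncomputable def weakRomanDominationNumber (n : ℕ) : ℕ :=
  sInf {k | ∃ f : FV n → ℕ, WeakRomanDominating n f ∧ ∑ v, f v = k}

/-- The weight of the copy `J^(m mod n)` in a vertex set `S`, i.e. the number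
of vertices of `S` among `a, b, c, d` of that copy. -/
noncomputable def copyWeight {n : ℕ} (S : Set (FV n)) (m : ℕ) : ℕ :=
  (S ∩ {v : FV n | (v.1 : ℕ) = m % n}).ncard

/-- The weight of the copy `J^(m mod n)` in a function `f`, i.e.
`f a + f b + f c + f d` over that copy. -/
def fCopyWeight {n : ℕ} (f : FV n → ℕ) (m : ℕ) : ℕ :=
  ∑ v ∈ Finset.univ.filter (fun v : FV n => (v.1 : ℕ) = m % n), f v

open Finset in
theorem fs_total (n : ℕ) (f : FV n → ℕ) (W : ℕ → ℕ) (hn : 3 ≤ n)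
    (hW : ∀ m (h : m % n < n), W m = ∑ t : Fin 4, f (⟨m % n, h⟩, t)) (j : ℕ) :
    ∑ i : Fin n, W ((i : ℕ) + j) = ∑ v, f v := by
  have : NeZero n := ⟨by omega⟩
  rw [Fintype.sum_prod_type]
  rw [← Equiv.sum_comp (Equiv.addRight (Fin.ofNat n j)) (fun i => ∑ t, f (i, t))]
  apply Finset.sum_congr rfl
  intro i _
  rw [hW _ (Nat.mod_lt _ (by omega))]
  apply Finset.sum_congr rfl
  intro t _
  congr 2
  ext
  simp [Fin.val_add]

theorem fs_copy (n : ℕ) (f : FV n → ℕ) (m : ℕ) (h : m % n < n) :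
    fCopyWeight f m = ∑ t : Fin 4, f (⟨m % n, h⟩, t) := by
  unfold fCopyWeight
  rw [Finset.sum_filter, Fintype.sum_prod_type, Finset.sum_eq_single ⟨m % n, h⟩]
  · simp
  · intro b _ hb
    have : (b : ℕ) ≠ m % n := fun h' => hb (Fin.ext h')
    simp [this]
  · simp

/-- neighbours in the infinite cover -/
def fsNb (v : ℕ × Fin 4) : List (ℕ × Fin 4) :=
  if v.2 = 0 then [(v.1, 1), (v.1, 2), (v.1, 3)]
  else [(v.1, 0), (v.1 - 1, v.2), (v.1 + 1, v.2)]

/-- relaxed local condition in the cover -/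
def fsL (G : ℕ → Fin 4 → ℕ) (v : ℕ × Fin 4) : Prop :=
  G v.1 v.2 = 0 → ∃ w ∈ fsNb v, 2 ≤ G w.1 w.2 ∨ (1 ≤ G w.1 w.2 ∧
    ∀ u ∈ fsNb w, u = v ∨ (v.2 = 1 ∧ w.2 = 1 ∧ u.2 = 1) ∨ 1 ≤ G u.1 u.2 ∨
      ∃ x ∈ fsNb u, x ≠ w ∧ 1 ≤ G x.1 x.2)

instance (G : ℕ → Fin 4 → ℕ) (v : ℕ × Fin 4) : Decidable (fsL G v) := by
  unfold fsL; infer_instance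

theorem fsL_mono {G G' : ℕ → Fin 4 → ℕ} (h : ∀ k t, G k t ≤ G' k t) {v : ℕ × Fin 4}
    (hL : fsL G v) : fsL G' v := by
  intro h0
  obtain ⟨w, hw, h1⟩ := hL (Nat.le_zero.mp (h0 ▸ h _ _))
  refine ⟨w, hw, ?_⟩
  rcases h1 with h1 | ⟨h1, h2⟩
  · exact Or.inl (h1.trans (h _ _))
  · refine Or.inr ⟨h1.trans (h _ _), fun u hu => ?_⟩
    rcases h2 u hu with h3 | h3 | h3 | ⟨x, hx, hxw, h3⟩
    · exact Or.inl h3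
    · exact Or.inr (Or.inl h3)
    · exact Or.inr (Or.inr (Or.inl (h3.trans (h _ _))))
    · exact Or.inr (Or.inr (Or.inr ⟨x, hx, hxw, h3.trans (h _ _)⟩))

def fsOf (cs : List (Fin 4 → ℕ)) (k : ℕ) (t : Fin 4) : ℕ :=
  if k < 3 then 2 else (cs.getD (k - 3) (fun _ => 2)) t

def fsC1 : List (Fin 4 → ℕ) := [![1,0,0,0], ![0,1,0,0], ![0,0,1,0], ![0,0,0,1]]
def fsC2 : List (Fin 4 → ℕ) := [![2,0,0,0], ![0,2,0,0], ![0,0,2,0], ![0,0,0,2],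
  ![1,1,0,0], ![1,0,1,0], ![1,0,0,1], ![0,1,1,0], ![0,1,0,1], ![0,0,1,1]]

def fsChk (cs : List (Fin 4 → ℕ)) : Prop :=
  ∀ k ∈ [3,4,5,6], ∀ t : Fin 4, fsL (fsOf cs) (k, t)

instance (cs : List (Fin 4 → ℕ)) : Decidable (fsChk cs) := by
  unfold fsChk; infer_instance

theorem fs111 : ∀ c0 ∈ fsC1, ∀ c1 ∈ fsC1, ∀ c2 ∈ fsC1, ¬ fsChk [c0, c1, c2] := by
  decide +kernel
theorem fs1121 : ∀ c0 ∈ fsC1, ∀ c1 ∈ fsC1, ∀ c2 ∈ fsC2, ∀ c3 ∈ fsC1,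
    ¬ fsChk [c0, c1, c2, c3] := by
  decide +kernel
theorem fs1211 : ∀ c0 ∈ fsC1, ∀ c1 ∈ fsC2, ∀ c2 ∈ fsC1, ∀ c3 ∈ fsC1,
    ¬ fsChk [c0, c1, c2, c3] := by
  decide +kernel

theorem fs_mem1 (c : Fin 4 → ℕ) (h : ∑ t, c t = 1) : c ∈ fsC1 := by
  have hc : c = ![c 0, c 1, c 2, c 3] := by ext t; fin_cases t <;> rfl
  rw [hc]
  simp only [Fin.sum_univ_four] at h
  have : (c 0 = 1 ∧ c 1 = 0 ∧ c 2 = 0 ∧ c 3 = 0) ∨ (c 0 = 0 ∧ c 1 = 1 ∧ c 2 = 0 ∧ c 3 = 0) ∨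
    (c 0 = 0 ∧ c 1 = 0 ∧ c 2 = 1 ∧ c 3 = 0) ∨ (c 0 = 0 ∧ c 1 = 0 ∧ c 2 = 0 ∧ c 3 = 1) := by omega
  rcases this with ⟨h0, h1, h2, h3⟩ | ⟨h0, h1, h2, h3⟩ | ⟨h0, h1, h2, h3⟩ | ⟨h0, h1, h2, h3⟩ <;>
    rw [h0, h1, h2, h3] <;> simp [fsC1]

theorem fs_mem2 (c : Fin 4 → ℕ) (h : ∑ t, c t = 2) : c ∈ fsC2 := by
  have hc : c = ![c 0, c 1, c 2, c 3] := by ext t; fin_cases t <;> rfl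
  rw [hc]
  simp only [Fin.sum_univ_four] at h
  generalize c 0 = x at *
  generalize c 1 = y at *
  generalize c 2 = z at *
  generalize c 3 = w at *
  clear hc
  have hx : x ≤ 2 := by omega
  have hy : y ≤ 2 := by omega
  have hz : z ≤ 2 := by omega
  interval_cases x <;> interval_cases y <;> interval_cases z <;>
    (try omega) <;> (have hw : w ≤ 2 := by omega) <;> interval_cases w <;>
    first | (exfalso; revert h; decide) | simp [fsC2]

/-- window lower bound in the cover -/
theorem fs_window (G : ℕ → Fin 4 → ℕ) (h2 : ∀ k t, G k t ≤ 2)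
    (hL : ∀ k t, 3 ≤ k → fsL G (k, t)) :
    (¬ (∑ t, G 3 t = 1 ∧ ∑ t, G 4 t = 1 ∧ ∑ t, G 5 t = 1)) ∧
    (¬ (∑ t, G 3 t = 1 ∧ ∑ t, G 4 t = 1 ∧ ∑ t, G 5 t = 2 ∧ ∑ t, G 6 t = 1)) ∧
    (¬ (∑ t, G 3 t = 1 ∧ ∑ t, G 4 t = 2 ∧ ∑ t, G 5 t = 1 ∧ ∑ t, G 6 t = 1)) := by
  have key3 : fsChk [G 3, G 4, G 5] := by
    intro k hk t
    refine fsL_mono (G := G) ?_ (hL k t (by simp at hk; omega))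
    intro k t
    unfold fsOf
    split
    · exact h2 k t
    · rcases Nat.lt_or_ge k 6 with h | h
      · interval_cases k <;> simp_all
      · obtain ⟨m, rfl⟩ := Nat.exists_eq_add_of_le h
        have : 6 + m - 3 = m + 3 := by omega
        simp [this, h2]
  have key4 : fsChk [G 3, G 4, G 5, G 6] := by
    intro k hk t
    refine fsL_mono (G := G) ?_ (hL k t (by simp at hk; omega))
    intro k t
    unfold fsOf
    split
    · exact h2 k t
    · rcases Nat.lt_or_ge k 7 with h | h
      · interval_cases k <;> simp_all
      · obtain ⟨m, rfl⟩ := Nat.exists_eq_add_of_le h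
        have : 7 + m - 3 = m + 4 := by omega
        simp [this, h2]
  refine ⟨?_, ?_, ?_⟩
  · rintro ⟨a, b, c⟩
    exact fs111 _ (fs_mem1 _ a) _ (fs_mem1 _ b) _ (fs_mem1 _ c) key3
  · rintro ⟨a, b, c, d⟩
    exact fs1121 _ (fs_mem1 _ a) _ (fs_mem1 _ b) _ (fs_mem2 _ c) _ (fs_mem1 _ d) key4
  · rintro ⟨a, b, c, d⟩
    exact fs1211 _ (fs_mem1 _ a) _ (fs_mem2 _ b) _ (fs_mem1 _ c) _ (fs_mem1 _ d) key4

def fsSw (s : ℕ) (t : Fin 4) : Fin 4 := if s % 2 = 1 then ![0, 1, 3, 2] t else t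

/-- covering map -/
def fsP (n : ℕ) (hn : 3 ≤ n) (v : ℕ × Fin 4) : FV n :=
  (⟨v.1 % n, Nat.mod_lt _ (by omega)⟩, fsSw (v.1 / n) v.2)

theorem fs_step (n : ℕ) (hn : 3 ≤ n) (k : ℕ) :
    (k % n + 1 < n ∧ (k + 1) % n = k % n + 1 ∧ (k + 1) / n = k / n) ∨
    (k % n + 1 = n ∧ (k + 1) % n = 0 ∧ (k + 1) / n = k / n + 1) := by
  have h := Nat.mod_lt k (show n > 0 by omega)
  have e := Nat.div_add_mod k n
  have key : ∀ q r, r < n → k + 1 = n * q + r → (k + 1) % n = r ∧ (k + 1) / n = q := by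
    intro q r hr he
    rw [he]
    constructor
    · rw [Nat.mul_add_mod, Nat.mod_eq_of_lt hr]
    · rw [Nat.mul_add_div (by omega), Nat.div_eq_of_lt hr]; rfl
  rcases Nat.lt_or_ge (k % n + 1) n with h1 | h1
  · exact Or.inl ⟨h1, key _ _ h1 (by omega)⟩
  · have h3 : k % n + 1 = n := by omega
    refine Or.inr ⟨h3, key (k / n + 1) 0 (by omega) ?_⟩
    rw [Nat.mul_add]; omega

def fsUp {n : ℕ} (v w : FV n) : Prop :=
  v.2 ≠ 0 ∧ (((v.1 : ℕ) + 1 = w.1 ∧ w.2 = v.2) ∨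
    ((v.1 : ℕ) + 1 = n ∧ (w.1 : ℕ) = 0 ∧ w.2 = ![0, 1, 3, 2] v.2))

theorem fs_adj_iff (n : ℕ) (hn : 3 ≤ n) (v w : FV n) : (flowerSnark n).Adj v w ↔
    (v.1 = w.1 ∧ ((v.2 = 0 ∧ w.2 ≠ 0) ∨ (v.2 ≠ 0 ∧ w.2 = 0))) ∨ fsUp v w ∨ fsUp w v := by
  obtain ⟨⟨i, hi⟩, s⟩ := v
  obtain ⟨⟨j, hj⟩, t⟩ := w
  have m1 : ∀ i, i < n → (i + 1 < n ∧ (i + 1) % n = i + 1) ∨ (i + 1 = n ∧ (i + 1) % n = 0) := by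
    intro i hi
    rcases Nat.lt_or_ge (i + 1) n with h | h
    · exact Or.inl ⟨h, Nat.mod_eq_of_lt h⟩
    · have : i + 1 = n := by omega
      exact Or.inr ⟨this, by rw [this, Nat.mod_self]⟩
  have mi := m1 i hi
  have mj := m1 j hj
  clear m1
  simp only [flowerSnark, SimpleGraph.fromRel_adj, fsUp, ne_eq, Prod.mk.injEq, Fin.mk.injEq]
  generalize (i + 1) % n = a at *
  generalize (j + 1) % n = b at *
  fin_cases s <;> fin_cases t <;> simp <;> omega

theorem fs_sw_succ (s : ℕ) (t : Fin 4) : fsSw (s + 1) t = ![0, 1, 3, 2] (fsSw s t) := by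
  unfold fsSw
  rcases Nat.mod_two_eq_zero_or_one s with hs | hs
  · have : (s + 1) % 2 = 1 := by omega
    simp only [hs, this]; simp
  · have : (s + 1) % 2 = 0 := by omega
    simp only [hs, this]
    revert t; decide

theorem fs_sw_zero (s : ℕ) (t : Fin 4) : fsSw s t = 0 ↔ t = 0 := by
  unfold fsSw
  split
  · revert t; decide
  · rfl

theorem fs_sw_surj (s : ℕ) (t : Fin 4) : ∃ t', fsSw s t' = t := by
  unfold fsSw
  split
  · revert t; decide
  · exact ⟨t, rfl⟩

theorem fs_invol (s t : Fin 4) (h : (![0, 1, 3, 2] : Fin 4 → Fin 4) s = ![0, 1, 3, 2] t) :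
    s = t := by
  revert s t; decide

theorem fs_up (n : ℕ) (hn : 3 ≤ n) (k : ℕ) (t : Fin 4) (ht : t ≠ 0) :
    fsUp (fsP n hn (k, t)) (fsP n hn (k + 1, t)) := by
  refine ⟨fun h => ht ((fs_sw_zero _ _).mp h), ?_⟩
  rcases fs_step n hn k with ⟨h1, h2, h3⟩ | ⟨h1, h2, h3⟩
  · left; simp [fsP, h2, h3]
  · right
    refine ⟨h1, h2, ?_⟩
    simp only [fsP, h3, fs_sw_succ]

theorem fs_adj_up (n : ℕ) (hn : 3 ≤ n) (k : ℕ) (t : Fin 4) (ht : t ≠ 0) :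
    (flowerSnark n).Adj (fsP n hn (k, t)) (fsP n hn (k + 1, t)) :=
  (fs_adj_iff n hn _ _).mpr (Or.inr (Or.inl (fs_up n hn k t ht)))

theorem fs_up_fun {n : ℕ} {v w w' : FV n} (h : fsUp v w) (h' : fsUp v w') : w = w' := by
  obtain ⟨_, h⟩ := h
  obtain ⟨_, h'⟩ := h'
  have := w.1.2
  have := w'.1.2
  rcases h with ⟨a, b⟩ | ⟨a, b, c⟩ <;> rcases h' with ⟨a', b'⟩ | ⟨a', b', c'⟩
  · exact Prod.ext (Fin.ext (by omega)) (by rw [b, b'])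
  · omega
  · omega
  · exact Prod.ext (Fin.ext (by omega)) (by rw [c, c'])

theorem fs_up_inj {n : ℕ} {v v' w : FV n} (h : fsUp v w) (h' : fsUp v' w) : v = v' := by
  obtain ⟨_, h⟩ := h
  obtain ⟨_, h'⟩ := h'
  rcases h with ⟨a, b⟩ | ⟨a, b, c⟩ <;> rcases h' with ⟨a', b'⟩ | ⟨a', b', c'⟩
  · exact Prod.ext (Fin.ext (by omega)) (by rw [← b, ← b'])
  · omega
  · omega
  · exact Prod.ext (Fin.ext (by omega)) (fs_invol _ _ (by rw [← c, ← c']))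

theorem fs_adj_in (n : ℕ) (hn : 3 ≤ n) (k : ℕ) (t : Fin 4) (ht : t ≠ 0) :
    (flowerSnark n).Adj (fsP n hn (k, 0)) (fsP n hn (k, t)) := by
  rw [fs_adj_iff n hn]
  left
  refine ⟨rfl, Or.inl ⟨(fs_sw_zero _ _).mpr rfl, fun h => ht ((fs_sw_zero _ _).mp h)⟩⟩

theorem fs_lift (n : ℕ) (hn : 3 ≤ n) (v : ℕ × Fin 4) (w : FV n) (h1 : 1 ≤ v.1)
    (hw : (flowerSnark n).Adj (fsP n hn v) w) : ∃ x ∈ fsNb v, fsP n hn x = w := by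
  obtain ⟨k, t⟩ := v
  obtain ⟨m, rfl⟩ : ∃ m, k = m + 1 := ⟨k - 1, by simp at h1; omega⟩
  have hz : ((fsP n hn (m + 1, t)).2 = 0) ↔ t = 0 := fs_sw_zero _ _
  rw [fs_adj_iff n hn] at hw
  rcases hw with ⟨h, h2⟩ | h | h
  · obtain ⟨t', ht'⟩ := fs_sw_surj ((m + 1) / n) w.2
    have hP : fsP n hn (m + 1, t') = w := Prod.ext h ht'
    have hz' : (w.2 = 0) ↔ t' = 0 := by rw [← ht']; exact fs_sw_zero _ _
    refine ⟨_, ?_, hP⟩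
    simp only [ne_eq, hz, hz'] at h2
    rcases h2 with ⟨rfl, h2⟩ | ⟨h2, rfl⟩
    · revert h2
      clear * -
      fin_cases t' <;> simp [fsNb]
    · simp [fsNb, h2]
  · have ht : t ≠ 0 := fun h' => h.1 (hz.mpr h')
    exact ⟨(m + 1 + 1, t), by simp [fsNb, ht], fs_up_fun (fs_up n hn _ t ht) h⟩
  · have ht : t ≠ 0 := by
      intro h'
      have h0 := hz.mpr h'
      obtain ⟨q, ⟨_, h⟩ | ⟨_, _, h⟩⟩ := h
      · exact q (by rw [← h, h0])
      · rw [h0] at h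
        exact q (fs_invol _ _ h.symm)
    exact ⟨(m, t), by simp [fsNb, ht], fs_up_inj (fs_up n hn _ t ht) h⟩

theorem fs_adj (n : ℕ) (hn : 3 ≤ n) (v w : ℕ × Fin 4) (h1 : 1 ≤ v.1) (hw : w ∈ fsNb v) :
    (flowerSnark n).Adj (fsP n hn v) (fsP n hn w) := by
  obtain ⟨k, t⟩ := v
  obtain ⟨m, rfl⟩ : ∃ m, k = m + 1 := ⟨k - 1, by simp at h1; omega⟩
  unfold fsNb at hw
  split at hw
  · rename_i h0
    simp only at h0
    subst h0
    simp only [List.mem_cons, List.not_mem_nil, or_false] at hw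
    rcases hw with rfl | rfl | rfl <;> exact fs_adj_in n hn _ _ (by decide)
  · rename_i h0
    simp only [List.mem_cons, List.not_mem_nil, or_false] at hw
    rcases hw with rfl | rfl | rfl
    · exact (fs_adj_in n hn _ _ h0).symm
    · exact (fs_adj_up n hn _ _ h0).symm
    · exact fs_adj_up n hn _ _ h0

theorem fs_inj (n : ℕ) (hn : 3 ≤ n) (k d : ℕ) (t t' : Fin 4) (hd : d ≤ 3)
    (h : fsP n hn (k, t) = fsP n hn (k + d, t')) :
    (d = 0 ∧ t = t') ∨ (d = 3 ∧ (t' = 2 → t ≠ 2) ∧ (t' = 3 → t ≠ 3)) := by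
  simp only [fsP, fsSw, Prod.ext_iff, Fin.ext_iff] at h
  obtain ⟨h1, h2⟩ := h
  have hk : k % n < n := Nat.mod_lt _ (by omega)
  have e1 := fs_step n hn k
  have e2 := fs_step n hn (k + 1)
  have e3 := fs_step n hn (k + 1 + 1)
  have : d = 0 ∨ d = 1 ∨ d = 2 ∨ d = 3 := by omega
  rcases this with rfl | rfl | rfl | rfl
  · left
    refine ⟨rfl, ?_⟩
    rcases Nat.mod_two_eq_zero_or_one (k / n) with hs | hs <;>
    fin_cases t <;> fin_cases t' <;> simp_all
  · omega
  · rw [show k + 2 = k + 1 + 1 from rfl] at h1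
    omega
  · rw [show k + 3 = k + 1 + 1 + 1 from rfl] at h1 h2
    right
    have h3 : (k + 1 + 1 + 1) / n = k / n + 1 := by omega
    rw [h3] at h2
    refine ⟨rfl, ?_, ?_⟩ <;>
    · rintro rfl rfl
      rcases Nat.mod_two_eq_zero_or_one (k / n) with hs | hs <;> simp [hs, Nat.add_mod] at h2

theorem fs_near (n : ℕ) (hn : 3 ≤ n) (v w u : ℕ × Fin 4) (hv : 3 ≤ v.1)
    (hw : w ∈ fsNb v) (hu : u ∈ fsNb w) (h : fsP n hn u = fsP n hn v) : u = v := by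
  obtain ⟨k, t⟩ := v
  obtain ⟨j, s⟩ := u
  have hjk : j ≤ k + 2 ∧ k ≤ j + 2 := by
    unfold fsNb at hw hu
    split at hw <;> simp at hw <;> rcases hw with rfl | rfl | rfl <;>
    split at hu <;> simp at hu <;> omega
  rcases le_total j k with hh | hh
  · obtain ⟨d, rfl⟩ := Nat.exists_eq_add_of_le hh
    rcases fs_inj n hn j d s t (by omega) h with ⟨rfl, rfl⟩ | ⟨h1, _⟩
    · rfl
    · omega
  · obtain ⟨d, rfl⟩ := Nat.exists_eq_add_of_le hh
    rcases fs_inj n hn k d t s (by omega) h.symm with ⟨rfl, rfl⟩ | ⟨h1, _⟩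
    · rfl
    · omega

theorem fs_tri (n : ℕ) (hn : 3 ≤ n) (v w u x : ℕ × Fin 4) (hv : 3 ≤ v.1)
    (hw : w ∈ fsNb v) (hu : u ∈ fsNb w) (hx : x ∈ fsNb u) (h : fsP n hn x = fsP n hn v) :
    v.2 = 1 ∧ w.2 = 1 ∧ u.2 = 1 := by
  obtain ⟨k, t⟩ := v
  obtain ⟨m, rfl⟩ : ∃ m, k = m + 3 := ⟨k - 3, by simp at hv; omega⟩
  obtain ⟨j, s⟩ := x
  have key : (j = m + 3 → s = t → (t = 1 ∧ w.2 = 1 ∧ u.2 = 1)) ∧ j ≤ m + 6 ∧ m ≤ j ∧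
     (j = m + 6 ∨ j = m → s = t ∧ w.2 = t ∧ u.2 = t ∧ t ≠ 0) := by
    clear h
    unfold fsNb at hw hu hx
    split at hw <;> simp at hw <;> rcases hw with rfl | rfl | rfl <;>
    split at hu <;> simp at hu <;> rcases hu with rfl | rfl | rfl <;>
    split at hx <;> simp at hx <;> rcases hx with ⟨rfl, rfl⟩ | ⟨rfl, rfl⟩ | ⟨rfl, rfl⟩ <;>
    simp_all <;> grind
  obtain ⟨k1, k2, k3, k4⟩ := key
  have fin : (∀ t : Fin 4, t ≠ 0 → t ≠ 2 → t ≠ 3 → t = 1) := by decide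
  rcases le_total j (m + 3) with hh | hh
  · obtain ⟨d, hd⟩ := Nat.exists_eq_add_of_le hh
    rw [hd] at h
    rcases fs_inj n hn j d s t (by omega) h with ⟨rfl, h2⟩ | ⟨rfl, h2, h3⟩
    · exact k1 (by omega) h2
    · obtain ⟨rfl, q1, q2, q3⟩ := k4 (by omega)
      have : s = 1 := fin s q3 (fun h => h2 h h) (fun h => h3 h h)
      simp_all
  · obtain ⟨d, rfl⟩ := Nat.exists_eq_add_of_le hh
    rcases fs_inj n hn _ d t s (by omega) h.symm with ⟨rfl, h2⟩ | ⟨rfl, h2, h3⟩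
    · exact k1 (by omega) h2.symm
    · obtain ⟨rfl, q1, q2, q3⟩ := k4 (by omega)
      have : s = 1 := fin s q3 (fun h => h2 h h) (fun h => h3 h h)
      simp_all

theorem fs_nb_low (v w : ℕ × Fin 4) (h : w ∈ fsNb v) : v.1 ≤ w.1 + 1 := by
  unfold fsNb at h
  split at h <;> simp at h <;> rcases h with rfl | rfl | rfl <;> simp <;> omega

theorem fs_local (n : ℕ) (hn : 3 ≤ n) (f : FV n → ℕ) (hf : WeakRomanDominating n f)
    (v : ℕ × Fin 4) (hv : 3 ≤ v.1) : fsL (fun k t => f (fsP n hn (k, t))) v := by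
  intro h0
  obtain ⟨w', hadj, h1, hdef⟩ := hf.2.2 (fsP n hn v) h0
  obtain ⟨w, hw, rfl⟩ := fs_lift n hn v w' (by omega) hadj
  have hwl := fs_nb_low _ _ hw
  refine ⟨w, hw, ?_⟩
  rcases Nat.lt_or_ge 1 (f (fsP n hn w)) with h2 | h2
  · exact Or.inl h2
  refine Or.inr ⟨h1, fun u hu => ?_⟩
  have hul := fs_nb_low _ _ hu
  by_contra hcon
  push Not at hcon
  obtain ⟨c1, c2, c3, c4⟩ := hcon
  have huv : fsP n hn u ≠ fsP n hn v := fun h => c1 (fs_near n hn v w u hv hw hu h)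
  have huw := (fs_adj n hn w u (by omega) hu).ne'
  apply hdef (fsP n hn u)
  constructor
  · simp only [huv, huw, if_false]
    simpa using c3
  · intro x' hx'
    obtain ⟨x, hx, rfl⟩ := fs_lift n hn u x' (by omega) hx'
    have hxv : fsP n hn x ≠ fsP n hn v := fun h => by
      obtain ⟨q1, q2, q3⟩ := fs_tri n hn v w u x hv hw hu hx h
      exact c2 q1 q2 q3
    simp only [hxv, if_false]
    split
    · omega
    · rename_i hne
      have := c4 x hx (fun h => hne (by rw [h]))
      simpa using this

theorem fs_shift (B : ℕ) (G : ℕ → Fin 4 → ℕ) (v : ℕ × Fin 4) (hv : 3 ≤ v.1)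
    (h : fsL G (B + v.1, v.2)) : fsL (fun k t => G (B + k) t) v := by
  have nbs : ∀ v w : ℕ × Fin 4, 1 ≤ v.1 → w ∈ fsNb (B + v.1, v.2) →
      ∃ w' ∈ fsNb v, w = (B + w'.1, w'.2) := by
    rintro ⟨k, t⟩ w hk hw
    unfold fsNb at hw ⊢
    simp only at hk
    split at hw <;> rename_i h0 <;> simp only at h0 <;> simp only [h0, if_true, if_false] <;>
      simp at hw <;> rcases hw with rfl | rfl | rfl <;> simp <;> omega
  have nbs' : ∀ v w : ℕ × Fin 4, 1 ≤ v.1 → w ∈ fsNb v → (B + w.1, w.2) ∈ fsNb (B + v.1, v.2) := by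
    rintro ⟨k, t⟩ w hk hw
    unfold fsNb at hw ⊢
    simp only at hk
    split at hw <;> rename_i h0 <;> simp only at h0 <;> simp only [h0, if_true, if_false] <;>
      simp at hw <;> rcases hw with rfl | rfl | rfl <;> simp <;> omega
  intro h0
  obtain ⟨w, hw, h1⟩ := h h0
  obtain ⟨w, hw', rfl⟩ := nbs v w (by omega) hw
  have hwl := fs_nb_low _ _ hw'
  refine ⟨w, hw', ?_⟩
  rcases h1 with h1 | ⟨h1, h2⟩
  · exact Or.inl h1
  refine Or.inr ⟨h1, fun u hu => ?_⟩
  have hul := fs_nb_low _ _ hu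
  rcases h2 _ (nbs' w u (by omega) hu) with h3 | h3 | h3 | ⟨x, hx, hxw, h3⟩
  · left
    simp only [Prod.ext_iff] at h3 ⊢
    exact ⟨by omega, h3.2⟩
  · exact Or.inr (Or.inl h3)
  · exact Or.inr (Or.inr (Or.inl h3))
  · obtain ⟨x, hx', rfl⟩ := nbs u x (by omega) hx
    exact Or.inr (Or.inr (Or.inr ⟨x, hx', fun h => hxw (by rw [h]), h3⟩))

theorem fs_colsum (n : ℕ) (hn : 3 ≤ n) (f : FV n → ℕ) (k m : ℕ) (h : k % n = m % n) :
    ∑ t, f (fsP n hn (k, t)) = fCopyWeight f m := by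
  rw [fs_copy n f m (Nat.mod_lt _ (by omega))]
  simp only [fsP, fsSw, h]
  rcases Nat.mod_two_eq_zero_or_one (k / n) with hs | hs <;>
    simp [hs, Fin.sum_univ_four]
  omega

theorem fs_pos (n : ℕ) (hn : 3 ≤ n) (f : FV n → ℕ) (hf : WeakRomanDominating n f) (m : ℕ) :
    1 ≤ fCopyWeight f m := by
  by_contra hc
  have h0 : fCopyWeight f m = 0 := by omega
  rw [fs_copy n f m (Nat.mod_lt _ (by omega))] at h0
  simp only [Finset.sum_eq_zero_iff, Finset.mem_univ, true_implies] at h0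
  apply hf.2.1 (⟨m % n, Nat.mod_lt _ (by omega)⟩, 0)
  refine ⟨h0 0, ?_⟩
  rintro ⟨j, s⟩ hw
  simp only [flowerSnark, SimpleGraph.fromRel_adj] at hw
  have : ⟨m % n, Nat.mod_lt _ (by omega)⟩ = j := by
    rcases hw.2 with h | h <;> simp at h
    exact h.1
  rw [← this]
  exact h0 s

theorem fs_win (n : ℕ) (hn : 3 ≤ n) (f : FV n → ℕ) (hf : WeakRomanDominating n f) (m : ℕ) :
    (6 ≤ fCopyWeight f m + fCopyWeight f (m + 1) + fCopyWeight f (m + 2) + fCopyWeight f (m + 3)) ∧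
    ¬ (fCopyWeight f (m + 1) = 1 ∧ fCopyWeight f (m + 2) = 1 ∧ fCopyWeight f (m + 3) = 1) := by
  have key : ∀ m, _ := fun m => fs_window (fun k t => f (fsP n hn (m + (n - 3) + k, t)))
    (fun k t => hf.1 _)
    (fun k t hk => fs_shift (m + (n - 3)) (fun k t => f (fsP n hn (k, t))) (k, t) hk
      (fs_local n hn f hf _ (by simp only; omega)))
  have cs : ∀ m j, ∑ t, f (fsP n hn (m + (n - 3) + (3 + j), t)) = fCopyWeight f (m + j) := by
    intro m j
    apply fs_colsum
    rw [show m + (n - 3) + (3 + j) = (m + j) + n by omega]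
    simp
  have c0 := fun m => cs m 0
  have c1 := fun m => cs m 1
  have c2 := fun m => cs m 2
  have c3 := fun m => cs m 3
  norm_num at c0 c1 c2 c3
  simp only [c0, c1, c2, c3] at key
  have k0 := key m
  have k1 := key (m + 1)
  simp only [Nat.add_assoc] at k1
  norm_num at k1
  have p0 := fs_pos n hn f hf m
  have p1 := fs_pos n hn f hf (m + 1)
  have p2 := fs_pos n hn f hf (m + 2)
  have p3 := fs_pos n hn f hf (m + 3)
  omega

/-- If `n ≥ 3` and `f` is a weak Roman dominating function on the flower snark
`J_n` of weight at most `3n/2`, then every four consecutive copies have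
combined weight exactly 6 in `f`, every copy has weight 1 or 2 in `f`, and the
weight of `f` equals `3n/2`. -/
theorem flowerSnark_weakRoman_weight6 (n : ℕ) (hn : 3 ≤ n)
    (f : FV n → ℕ) (hf : WeakRomanDominating n f)
    (hw : ((∑ v, f v : ℕ) : ℚ) ≤ 3 * n / 2) :
    (∀ i : Fin n, fCopyWeight f (i : ℕ) + fCopyWeight f ((i : ℕ) + 1) +
      fCopyWeight f ((i : ℕ) + 2) + fCopyWeight f ((i : ℕ) + 3) = 6) ∧
    (∀ i : Fin n, fCopyWeight f (i : ℕ) = 1 ∨ fCopyWeight f (i : ℕ) = 2) ∧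
    ((∑ v, f v : ℕ) : ℚ) = 3 * n / 2 := by
  have hw' : 2 * ∑ v, f v ≤ 3 * n := by
    have : (2 : ℚ) * ((∑ v, f v : ℕ) : ℚ) ≤ 3 * n := by linarith
    exact_mod_cast this
  have tot := fs_total n f (fCopyWeight f) hn (fs_copy n f)
  have hsum : ∑ i : Fin n, (fCopyWeight f (i : ℕ) + fCopyWeight f ((i : ℕ) + 1) +
      fCopyWeight f ((i : ℕ) + 2) + fCopyWeight f ((i : ℕ) + 3)) = 4 * ∑ v, f v := by
    simp only [Finset.sum_add_distrib]
    have t0 := tot 0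
    simp only [Nat.add_zero] at t0
    rw [t0, tot 1, tot 2, tot 3]
    ring
  have hge : ∀ i ∈ (Finset.univ : Finset (Fin n)), 6 ≤ (fCopyWeight f (i : ℕ) +
      fCopyWeight f ((i : ℕ) + 1) + fCopyWeight f ((i : ℕ) + 2) + fCopyWeight f ((i : ℕ) + 3)) :=
    fun i _ => (fs_win n hn f hf i).1
  have h6 : ∑ i : Fin n, 6 = n * 6 := by simp
  have hle := Finset.sum_le_sum hge
  have heq : ∑ i : Fin n, 6 = ∑ i : Fin n, (fCopyWeight f (i : ℕ) + fCopyWeight f ((i : ℕ) + 1) +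
      fCopyWeight f ((i : ℕ) + 2) + fCopyWeight f ((i : ℕ) + 3)) := by omega
  have hall := (Finset.sum_eq_sum_iff_of_le hge).mp heq
  refine ⟨fun i => (hall i (Finset.mem_univ i)).symm, fun i => ?_, ?_⟩
  · have e := hall i (Finset.mem_univ i)
    have q := (fs_win n hn f hf i).2
    have p0 := fs_pos n hn f hf i
    have p1 := fs_pos n hn f hf (i + 1)
    have p2 := fs_pos n hn f hf (i + 2)
    have p3 := fs_pos n hn f hf (i + 3)
    omega
  · have : 2 * ∑ v, f v = 3 * n := by omega
    have h' : (2 : ℚ) * ((∑ v, f v : ℕ) : ℚ) = 3 * n := by exact_mod_cast this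
    linarith
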